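/- arXiv:1904.04298 — 5 statements merged into one kernel-verified Lean document; each statement's English description precedes it below -/
import Mathlib

section
/- Every diffuse group has the unique n-fold product property for every integer n ≥ 2; in particular every diffuse group has the unique product property. -/
/-- An element `s` of a subset `S` of a group is an *extremal point* of `S` if for
every `g ≠ 1`, either `s * g⁻¹ ∉ S` or `s * g ∉ S`. A group is *diffuse* if every
finite nonempty subset has an extremal point. -/
def IsDiffuse (G : Type*) [Group G] : Prop :=
  ∀ S : Finset G, S.Nonempty →
    ∃ s ∈ S, ∀ g : G, g ≠ 1 → s * g⁻¹ ∉ S ∨ s * g ∉ S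

/-- A group `G` has the *unique `n`-fold product property* if for every `n`-tuple
of finite nonempty subsets of `G` there is an element `g ∈ G` expressible in one
and only one way as a product `a 0 * a 1 * ⋯ * a (n-1)` with `a i ∈ A i`. -/
def UniqueNFoldProduct (G : Type*) [Group G] (n : ℕ) : Prop :=
  ∀ A : Fin n → Finset G, (∀ i, (A i).Nonempty) →
    ∃ g : G, ∃! a : Fin n → G, (∀ i, a i ∈ A i) ∧ (List.ofFn a).prod = g

/-- An extremal point of a product `A 0 * ⋯ * A (n - 1)` of subsets of a group has at most one
factorization with `i`-th factor in `A i`. -/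
theorem eq_of_prod_ofFn_eq_of_extremal {G : Type*} [Group G] {n : ℕ} (A : Fin n → Set G) (c : G)
    (hc : ∀ (g : G) (x y : Fin n → G), (∀ i, x i ∈ A i) → (∀ i, y i ∈ A i) →
      (List.ofFn x).prod = c * g⁻¹ → (List.ofFn y).prod = c * g → g = 1)
    (a b : Fin n → G) (ha : ∀ i, a i ∈ A i) (hb : ∀ i, b i ∈ A i)
    (hac : (List.ofFn a).prod = c) (hbc : (List.ofFn b).prod = c) : a = b := by
  induction n generalizing c with
  | zero => exact Subsingleton.elim _ _
  | succ n ih =>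
    rw [List.ofFn_succ, List.prod_cons] at hac hbc
    have hcons (x : G) (hx : x ∈ A 0) (y : Fin n → G) (hy : ∀ i, y i ∈ A i.succ) :
        ∀ i, (Fin.cons x y : Fin (n + 1) → G) i ∈ A i :=
      Fin.cases (by simpa using hx) (by simpa using hy)
    set q := (List.ofFn fun i => a i.succ).prod with hq
    set r := (List.ofFn fun i => b i.succ).prod with hr
    have hqr : q⁻¹ * r = 1 := by
      refine hc (q⁻¹ * r) (Fin.cons (b 0) fun i => a i.succ) (Fin.cons (a 0) fun i => b i.succ)
        (hcons _ (hb 0) _ fun i => ha _) (hcons _ (ha 0) _ fun i => hb _) ?_ ?_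
      · simp [List.ofFn_succ, ← hq, ← hbc, mul_assoc]
      · simp [List.ofFn_succ, ← hr, ← hac, mul_assoc]
    have hqr' : q = r := inv_mul_eq_one.mp hqr
    have h0 : a 0 = b 0 := by
      rw [← hbc, hqr'] at hac
      exact mul_right_cancel hac
    have htail : (fun i : Fin n => a i.succ) = fun i => b i.succ := by
      refine ih (fun i => A i.succ) q (fun g x y hx hy hxg hyg => ?_) _ _
        (fun i => ha _) (fun i => hb _) rfl hqr'.symm
      refine hc g (Fin.cons (a 0) x) (Fin.cons (a 0) y)
        (hcons _ (ha 0) _ hx) (hcons _ (ha 0) _ hy) ?_ ?_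
      · simp [List.ofFn_succ, hxg, ← hac, mul_assoc]
      · simp [List.ofFn_succ, hyg, ← hac, mul_assoc]
    funext i
    exact Fin.cases h0 (congrFun htail) i

theorem IsDiffuse.uniqueNFoldProduct {G : Type*} [Group G] (hG : IsDiffuse G) (n : ℕ) :
    UniqueNFoldProduct G n := by
  classical
  intro A hA
  obtain ⟨c, hcS, hc⟩ := hG ((Fintype.piFinset A).image fun a => (List.ofFn a).prod)
    ((Fintype.piFinset_nonempty.mpr hA).image _)
  simp only [Finset.mem_image, Fintype.mem_piFinset] at hcS hc
  obtain ⟨a, ha, hac⟩ := hcS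
  refine ⟨c, a, ⟨ha, hac⟩, fun b hb => ?_⟩
  refine eq_of_prod_ofFn_eq_of_extremal (fun i => (A i : Set G)) c
    (fun g x y hx hy hxg hyg => ?_) b a hb.1 ha hb.2 hac
  by_contra hg
  exact (hc g hg).elim (fun h => h ⟨x, hx, hxg⟩) fun h => h ⟨y, hy, hyg⟩

/-- Every diffuse group has the unique `n`-fold product property for every `n ≥ 2`;
in particular, every diffuse group has the (usual) unique product property. -/
theorem uniqueNFoldProduct_of_isDiffuse {G : Type*} [Group G] (hG : IsDiffuse G) :
    (∀ n : ℕ, 2 ≤ n → UniqueNFoldProduct G n) ∧ UniqueNFoldProduct G 2 :=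
  ⟨fun n _ => hG.uniqueNFoldProduct n, hG.uniqueNFoldProduct 2⟩
end

section
/- Every group admitting a strongly locally invariant order (SLIO) is diffuse: if a group G admits a total order such that for every s ∈ G and every g ∈ G with g ≠ 1, exactly one of sg⁻¹ > s and sg > s holds, then every finite nonempty subset of G has an extremal point. -/
/-- Every group admitting a strongly locally invariant order is diffuse: if `G`
admits a total order `le` such that for every `s` and every `g ≠ 1` exactly one of
`s * g⁻¹ > s` and `s * g > s` holds (where `x > s` means `¬ le x s`), then every
finite nonempty subset of `G` has an extremal point, i.e. an element `s` such that
for every `g ≠ 1`, either `s * g⁻¹` or `s * g` lies outside the subset. -/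
theorem isDiffuse_of_slio {G : Type*} [Group G]
    (h : ∃ le : G → G → Prop, IsLinearOrder G le ∧
      ∀ s g : G, g ≠ 1 → Xor' (¬ le (s * g⁻¹) s) (¬ le (s * g) s)) :
    ∀ S : Finset G, S.Nonempty →
      ∃ s ∈ S, ∀ g : G, g ≠ 1 → s * g⁻¹ ∉ S ∨ s * g ∉ S := by
  obtain ⟨le, hle, hxor⟩ := h
  intro S hS
  let _ : LinearOrder G :=
    { le := le
      le_refl := hle.refl
      le_trans := hle.trans
      le_antisymm := hle.antisymm
      le_total := hle.total
      toDecidableLE := Classical.decRel _ }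
  obtain ⟨s, hs, hmax⟩ := S.exists_max_image id hS
  refine ⟨s, hs, fun g hg => ?_⟩
  rcases hxor s g hg with ⟨hgt, -⟩ | ⟨hgt, -⟩
  · exact Or.inl fun hmem => hgt (hmax _ hmem)
  · exact Or.inr fun hmem => hgt (hmax _ hmem)
end

section
/- Let κ be an infinite cardinal, Ω a set of cardinality κ, and (G_i)_{i∈I} a family of finite groups indexed by a set I of cardinality at most κ. Then the direct product ∏_{i∈I} G_i is embeddable in the full permutation group of Ω. -/
universe u

/-- A product of groups acts faithfully on the disjoint union of its factors, each factor acting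
on itself by left translation. -/
theorem exists_injective_pi_hom_perm_sigma {I : Type*} (G : I → Type*) [∀ i, Group (G i)] :
    ∃ f : (∀ i, G i) →* Equiv.Perm (Σ i, G i), Function.Injective f := by
  refine ⟨(Equiv.Perm.sigmaCongrRightHom G).comp
    (MonoidHom.piMap fun i => MulAction.toPermHom (G i) (G i)),
    Equiv.Perm.sigmaCongrRightHom_injective.comp ?_⟩
  exact Function.Injective.piMap fun i => MulAction.toPerm_injective

/-- A disjoint union of at most `κ` finite types, with `κ` infinite, has cardinality at most
`κ`. -/
theorem mk_sigma_le_of_finite {κ : Cardinal.{u}} (hκ : Cardinal.aleph0 ≤ κ) {I : Type u}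
    (hI : Cardinal.mk I ≤ κ) (G : I → Type u) [∀ i, Finite (G i)] :
    Cardinal.mk (Σ i, G i) ≤ κ := by
  rw [Cardinal.mk_sigma]
  calc Cardinal.sum (fun i => Cardinal.mk (G i))
      ≤ Cardinal.sum (fun _ : I => κ) :=
        Cardinal.sum_le_sum _ _ fun i => (Cardinal.lt_aleph0_of_finite (G i)).le.trans hκ
    _ = Cardinal.mk I * κ := Cardinal.sum_const' I κ
    _ ≤ κ * κ := mul_le_mul_left hI κ
    _ = κ := Cardinal.mul_eq_self hκ

/-- Let `κ` be an infinite cardinal, `Ω` a set of cardinality `κ`, and `(G i)` a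
family of finite groups indexed by a set `I` of cardinality at most `κ`.  Then the
direct product `∏ i, G i` embeds in the full permutation group of `Ω`. -/
theorem pi_finite_groups_embeds_in_perm {κ : Cardinal.{u}}
    (hκ : Cardinal.aleph0 ≤ κ) {Ω : Type u} (hΩ : Cardinal.mk Ω = κ)
    {I : Type u} (hI : Cardinal.mk I ≤ κ) (G : I → Type u)
    [∀ i, Group (G i)] [∀ i, Finite (G i)] :
    ∃ f : (∀ i, G i) →* Equiv.Perm Ω, Function.Injective f := by
  obtain ⟨f, hf⟩ := exists_injective_pi_hom_perm_sigma G
  obtain ⟨e⟩ : Nonempty ((Σ i, G i) ↪ Ω) :=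
    (Cardinal.le_def _ _).mp ((mk_sigma_le_of_finite hκ hI G).trans_eq hΩ.symm)
  exact ⟨(Equiv.Perm.viaEmbeddingHom e).comp f,
    (Equiv.Perm.viaEmbeddingHom_injective e).comp hf⟩
end

section
/- Let R be a ring, n a positive integer, and α an automorphism of R with αⁿ = id, such that every element of R fixed by α lies in the center of R, and such that R has no n-torsion (i.e., nx = 0 implies x = 0 for x ∈ R). Then the commutator ideal of R is nil. -/
/-- A family of additive subgroups of `R` that multiplies like a `ℤ/n`-grading, whose
components in degrees divisible by `n` are central. -/
structure CentralGrading (n : ℕ) (R : Type*) [Ring R] where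
  component : ℕ → AddSubgroup R
  mul_mem : ∀ {i j : ℕ} {x y : R}, x ∈ component i → y ∈ component j →
    x * y ∈ component (i + j)
  one_mem : (1 : R) ∈ component 0
  mem_center : ∀ {k : ℕ} {x : R}, n ∣ k → x ∈ component k → x ∈ Subring.center R

open Classical in
/-- Extension by zero of a ring homomorphism defined on the center. -/
noncomputable def centerExtend {R F : Type*} [Ring R] [Zero F] (φ : Subring.center R → F)
    (x : R) : F :=
  if h : x ∈ Subring.center R then φ ⟨x, h⟩ else 0

section CenterExtend

variable {R F : Type*} [Ring R] [Field F] (φ : Subring.center R →+* F)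

theorem centerExtend_of_mem {x : R} (hx : x ∈ Subring.center R) :
    centerExtend φ x = φ ⟨x, hx⟩ := dif_pos hx

theorem centerExtend_mul {x y : R} (hx : x ∈ Subring.center R) (hy : y ∈ Subring.center R) :
    centerExtend φ (x * y) = centerExtend φ x * centerExtend φ y := by
  rw [centerExtend_of_mem φ hx, centerExtend_of_mem φ hy,
    centerExtend_of_mem φ (mul_mem hx hy), ← map_mul]
  rfl

theorem centerExtend_sub {x y : R} (hx : x ∈ Subring.center R) (hy : y ∈ Subring.center R) :
    centerExtend φ (x - y) = centerExtend φ x - centerExtend φ y := by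
  rw [centerExtend_of_mem φ hx, centerExtend_of_mem φ hy,
    centerExtend_of_mem φ (sub_mem hx hy), ← map_sub]
  rfl

theorem centerExtend_pow {x : R} (hx : x ∈ Subring.center R) (m : ℕ) :
    centerExtend φ (x ^ m) = centerExtend φ x ^ m := by
  rw [centerExtend_of_mem φ hx, centerExtend_of_mem φ (pow_mem hx m), ← map_pow]
  rfl

end CenterExtend

theorem pow_mul_pow_of_mul_mem_center {R : Type*} [Ring R] {x y : R}
    (h : x * y ∈ Subring.center R) (m : ℕ) : x ^ m * y ^ m = (x * y) ^ m := by
  induction m with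
  | zero => simp
  | succ m ih =>
    calc x ^ (m + 1) * y ^ (m + 1) = x ^ m * (x * y) * y ^ m := by
          rw [pow_succ, pow_succ']; simp only [mul_assoc]
      _ = x * y * (x ^ m * y ^ m) := by
          rw [Subring.mem_center_iff.mp h (x ^ m)]; simp only [mul_assoc]
      _ = (x * y) ^ (m + 1) := by rw [ih, pow_succ']

namespace CentralGrading

variable {n : ℕ} {R F : Type*} [Ring R] [Field F] (D : CentralGrading n R)
  (φ : Subring.center R →+* F) {i j k : ℕ} {x y w : R}

theorem pow_mem (hx : x ∈ D.component i) (m : ℕ) : x ^ m ∈ D.component (m * i) := by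
  induction m with
  | zero => simpa using D.one_mem
  | succ m ih => rw [pow_succ, add_mul, one_mul]; exact D.mul_mem ih hx

theorem centerExtend_mul_comm (hx : x ∈ D.component i) (hy : y ∈ D.component j)
    (hn : n ∣ i + j) : centerExtend φ (x * y) = centerExtend φ (y * x) := by
  have hc := D.mem_center hn (D.mul_mem hx hy)
  have hd := D.mem_center (add_comm i j ▸ hn) (D.mul_mem hy hx)
  have h₁ : x * y * (x * y) = x * y * (y * x) := by
    calc x * y * (x * y) = x * (y * x) * y := by simp only [mul_assoc]
      _ = y * x * (x * y) := by
        rw [Subring.mem_center_iff.mp hd x]; simp only [mul_assoc]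
      _ = x * y * (y * x) := (Subring.mem_center_iff.mp hd (x * y)).symm
  have h₂ : y * x * (y * x) = x * y * (y * x) := by
    calc y * x * (y * x) = y * (x * y) * x := by simp only [mul_assoc]
      _ = x * y * (y * x) := by
        rw [Subring.mem_center_iff.mp hc y]; simp only [mul_assoc]
  have e₁ := congrArg (centerExtend φ) h₁
  have e₂ := congrArg (centerExtend φ) h₂
  rw [centerExtend_mul φ hc hc, centerExtend_mul φ hc hd] at e₁
  rw [centerExtend_mul φ hd hd, centerExtend_mul φ hc hd] at e₂
  have : (centerExtend φ (x * y) - centerExtend φ (y * x)) ^ 2 = 0 := by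
    linear_combination e₁ + e₂
  exact sub_eq_zero.mp (pow_eq_zero_iff two_ne_zero |>.mp this)

theorem centerExtend_pow_eq_of_ne_zero (hn : 0 < n) {a b g : ℕ} (hb : 0 < b)
    (hx : x ∈ D.component (a * g)) (hy : y ∈ D.component (b * g)) (hw : w ∈ D.component k)
    (hk : n ∣ a * g + b * g + k) (hyn : centerExtend φ (y ^ n) ≠ 0) :
    centerExtend φ (x * y * w) ^ b = centerExtend φ (y * x * w) ^ b := by
  obtain ⟨m, rfl⟩ : ∃ m, n = m + 1 := ⟨n - 1, by omega⟩
  obtain ⟨b', rfl⟩ : ∃ b', b = b' + 1 := ⟨b - 1, by omega⟩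
  have hyc : y ^ (m + 1) ∈ Subring.center R :=
    D.mem_center (dvd_mul_right _ _) (D.pow_mem hy _)
  have hYc : (y ^ (m + 1)) ^ a ∈ Subring.center R := _root_.pow_mem hyc a
  have hc : x ^ (b' + 1) * y ^ (a * m) ∈ Subring.center R :=
    D.mem_center (k := (b' + 1) * (a * g) + a * m * ((b' + 1) * g))
      ⟨a * (b' + 1) * g, by ring⟩ (D.mul_mem (D.pow_mem hx _) (D.pow_mem hy _))
  have hxyw : x * (y * w) ∈ Subring.center R :=
    D.mem_center (by rwa [← add_assoc]) (D.mul_mem hx (D.mul_mem hy hw))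
  have hxwy : x * (w * y) ∈ Subring.center R :=
    D.mem_center (by convert hk using 1; ring) (D.mul_mem hx (D.mul_mem hw hy))
  have hwy : w * (y * w) ^ b' = (w * y) ^ b' * w := by
    clear * -
    induction b' with
    | zero => simp
    | succ b' ih => rw [pow_succ, ← mul_assoc, ih, pow_succ]; simp only [mul_assoc]
  have hcomm : (y ^ (m + 1)) ^ a * (x ^ (b' + 1) * y) =
      (y ^ (m + 1)) ^ a * (y * x ^ (b' + 1)) := by
    have hsplit : (y ^ (m + 1)) ^ a = y ^ (a * m) * y ^ a := by
      rw [← pow_mul, ← pow_add, Nat.mul_comm (m + 1) a, mul_add, mul_one]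
    calc (y ^ (m + 1)) ^ a * (x ^ (b' + 1) * y)
        = x ^ (b' + 1) * y * (y ^ (m + 1)) ^ a := (Subring.mem_center_iff.mp hYc _).symm
      _ = x ^ (b' + 1) * y ^ (a * m) * y * y ^ a := by
          rw [hsplit, mul_assoc _ y, ← mul_assoc y, (Commute.self_pow y (a * m)).eq]
          simp only [mul_assoc]
      _ = y * (x ^ (b' + 1) * y ^ (a * m)) * y ^ a := by
          rw [Subring.mem_center_iff.mp hc y]
      _ = y * x ^ (b' + 1) * (y ^ (m + 1)) ^ a := by rw [hsplit]; simp only [mul_assoc]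
      _ = (y ^ (m + 1)) ^ a * (y * x ^ (b' + 1)) := Subring.mem_center_iff.mp hYc _
  have hl : x ^ (b' + 1) * y * (w * (y * w) ^ b') = (x * (y * w)) ^ (b' + 1) := by
    rw [← pow_mul_pow_of_mul_mem_center hxyw, pow_succ' (y * w)]; simp only [mul_assoc]
  have hmem : x ^ (b' + 1) * (w * (y * w) ^ b') ∈
      D.component ((b' + 1) * (a * g) + (k + b' * ((b' + 1) * g + k))) :=
    D.mul_mem (D.pow_mem hx _) (D.mul_mem hw (D.pow_mem (D.mul_mem hy hw) _))
  have hdeg : m + 1 ∣ (b' + 1) * g + ((b' + 1) * (a * g) + (k + b' * ((b' + 1) * g + k))) := by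
    rw [show (b' + 1) * g + ((b' + 1) * (a * g) + (k + b' * ((b' + 1) * g + k))) =
      (b' + 1) * (a * g + (b' + 1) * g + k) by ring]
    exact hk.mul_left _
  have hr : centerExtend φ (y * x ^ (b' + 1) * (w * (y * w) ^ b')) =
      centerExtend φ (y * x * w) ^ (b' + 1) := by
    rw [mul_assoc, D.centerExtend_mul_comm φ hy hmem hdeg, hwy, mul_assoc, mul_assoc, ← pow_succ,
      pow_mul_pow_of_mul_mem_center hxwy, centerExtend_pow φ hxwy, ← mul_assoc, mul_assoc y,
      D.centerExtend_mul_comm φ (D.mul_mem hx hw) hy (by convert hk using 1; ring)]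
  have hrc : y * x ^ (b' + 1) * (w * (y * w) ^ b') ∈ Subring.center R := by
    rw [mul_assoc]; exact D.mem_center hdeg (D.mul_mem hy hmem)
  have key := congrArg (fun z ↦ centerExtend φ (z * (w * (y * w) ^ b'))) hcomm
  simp only [mul_assoc ((y ^ (m + 1)) ^ a)] at key
  rw [hl, centerExtend_mul φ hYc (_root_.pow_mem hxyw _), centerExtend_mul φ hYc hrc, hr,
    centerExtend_pow φ hyc, centerExtend_pow φ hxyw, ← mul_assoc] at key
  exact mul_left_cancel₀ (pow_ne_zero a hyn) key

theorem centerExtend_swap_of_ne_zero (hn : 0 < n) (hi : 0 < i) (hj : 0 < j)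
    (hx : x ∈ D.component i) (hy : y ∈ D.component j) (hw : w ∈ D.component k)
    (hk : n ∣ i + j + k) (h : centerExtend φ (x * y * w) ≠ 0) :
    centerExtend φ (x * y * w) = centerExtend φ (y * x * w) := by
  have hxyw : x * (y * w) ∈ Subring.center R :=
    D.mem_center (by rwa [← add_assoc]) (D.mul_mem hx (D.mul_mem hy hw))
  have hywx : y * (w * x) ∈ Subring.center R :=
    D.mem_center (by convert hk using 1; ring) (D.mul_mem hy (D.mul_mem hw hx))
  have hxn : centerExtend φ (x ^ n) ≠ 0 := by
    have := congrArg (centerExtend φ) (pow_mul_pow_of_mul_mem_center hxyw n)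
    rw [centerExtend_mul φ (D.mem_center (dvd_mul_right _ _) (D.pow_mem hx n))
      (D.mem_center (dvd_mul_right _ _) (D.pow_mem (D.mul_mem hy hw) n)),
      centerExtend_pow φ hxyw, ← mul_assoc] at this
    exact left_ne_zero_of_mul (this ▸ pow_ne_zero n h)
  have hyn : centerExtend φ (y ^ n) ≠ 0 := by
    have := congrArg (centerExtend φ) (pow_mul_pow_of_mul_mem_center hywx n)
    rw [centerExtend_mul φ (D.mem_center (dvd_mul_right _ _) (D.pow_mem hy n))
      (D.mem_center (dvd_mul_right _ _) (D.pow_mem (D.mul_mem hw hx) n)),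
      centerExtend_pow φ hywx, ← mul_assoc y,
      ← D.centerExtend_mul_comm φ hx (D.mul_mem hy hw) (by rwa [← add_assoc]),
      ← mul_assoc] at this
    exact left_ne_zero_of_mul (this ▸ pow_ne_zero n h)
  obtain ⟨g, a, b, hg, hab, rfl, rfl⟩ := Nat.exists_coprime' (Nat.gcd_pos_of_pos_left j hi)
  have hb := D.centerExtend_pow_eq_of_ne_zero φ hn (Nat.pos_of_mul_pos_right hj) hx hy hw hk hyn
  have ha := D.centerExtend_pow_eq_of_ne_zero φ hn (Nat.pos_of_mul_pos_right hi) hy hx hw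
    (by rwa [add_comm (b * g)]) hxn
  have hone : (centerExtend φ (y * x * w) / centerExtend φ (x * y * w)) ^ a.gcd b = 1 := by
    refine pow_gcd_eq_one.mpr ⟨?_, ?_⟩
    · rw [div_pow, ha, div_self (pow_ne_zero _ h)]
    · rw [div_pow, ← hb, div_self (pow_ne_zero _ h)]
  rw [hab.gcd_eq_one, pow_one, div_eq_one_iff_eq h] at hone
  exact hone.symm

theorem centerExtend_swap (hn : 0 < n)
    (hx : x ∈ D.component i) (hy : y ∈ D.component j) (hw : w ∈ D.component k)
    (hk : n ∣ i + j + k) :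
    centerExtend φ (x * y * w) = centerExtend φ (y * x * w) := by
  rcases i.eq_zero_or_pos with rfl | hi
  · rw [Subring.mem_center_iff.mp (D.mem_center (dvd_zero n) hx) y]
  rcases j.eq_zero_or_pos with rfl | hj
  · rw [Subring.mem_center_iff.mp (D.mem_center (dvd_zero n) hy) x]
  by_cases h : centerExtend φ (x * y * w) = 0
  · by_cases h' : centerExtend φ (y * x * w) = 0
    · rw [h, h']
    · exact (D.centerExtend_swap_of_ne_zero φ hn hj hi hy hx hw (by rwa [add_comm j]) h').symm
  · exact D.centerExtend_swap_of_ne_zero φ hn hi hj hx hy hw hk h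

end CentralGrading

theorem isNilpotent_of_centerExtend_eq_zero.{u} {R : Type u} [Ring R] {x : R}
    (hx : x ∈ Subring.center R)
    (h : ∀ (F : Type u) [Field F] (φ : Subring.center R →+* F), centerExtend φ x = 0) :
    IsNilpotent x := by
  have : IsNilpotent (⟨x, hx⟩ : Subring.center R) := by
    refine nilpotent_iff_mem_prime.mpr fun P hP ↦ ?_
    have := h (FractionRing (Subring.center R ⧸ P))
      ((algebraMap (Subring.center R ⧸ P) _).comp (Ideal.Quotient.mk P))
    rw [centerExtend_of_mem _ hx, RingHom.comp_apply] at this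
    exact Ideal.Quotient.eq_zero_iff_mem.mp
      ((map_eq_zero_iff _ (IsFractionRing.injective (Subring.center R ⧸ P)
        (FractionRing (Subring.center R ⧸ P)))).mp this)
  exact this.map (Subring.center R).subtype

theorem isNilpotent_add_mul_of_mem_center {R : Type*} [Ring R] {y z r : R} (hy : IsNilpotent y)
    (hz : IsNilpotent z) (hzc : z ∈ Subring.center R) : IsNilpotent (y + z * r) := by
  have hpow : ∀ m : ℕ, ∃ s, (y + z * r) ^ m = y ^ m + z * s := by
    intro m
    induction m with
    | zero => exact ⟨0, by simp⟩
    | succ m ih =>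
      obtain ⟨s, hs⟩ := ih
      refine ⟨y ^ m * r + s * (y + z * r), ?_⟩
      rw [pow_succ, hs, add_mul, mul_add (y ^ m), ← mul_assoc (y ^ m) z,
        Subring.mem_center_iff.mp hzc (y ^ m), mul_add z, pow_succ]
      simp only [mul_assoc, add_assoc]
  obtain ⟨m, hm⟩ := hy
  obtain ⟨s, hs⟩ := hpow m
  rw [hm, zero_add] at hs
  refine IsNilpotent.of_pow (m := m) ?_
  rw [hs]
  exact Commute.isNilpotent_mul_right (Subring.mem_center_iff.mp hzc s).symm hz

/-- Every element of the ideal generated by the central nilpotent elements is nilpotent. -/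
theorem isNilpotent_of_mem_closure_center_nilpotent_mul {R : Type*} [Ring R] {x : R}
    (hx : x ∈ AddSubgroup.closure
      {x : R | ∃ z r, IsNilpotent z ∧ z ∈ Subring.center R ∧ x = z * r}) :
    IsNilpotent x := by
  suffices ∀ y, IsNilpotent y → IsNilpotent (y + x) by simpa using this 0 IsNilpotent.zero
  induction hx using AddSubgroup.closure_induction with
  | mem x hx =>
    obtain ⟨z, r, hz, hzc, rfl⟩ := hx
    exact fun y hy ↦ isNilpotent_add_mul_of_mem_center hy hz hzc
  | zero => simp
  | add x x' _ _ ih ih' => exact fun y hy ↦ add_assoc y x x' ▸ ih' _ (ih y hy)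
  | neg x _ ih =>
    intro y hy
    have := (ih (-y) hy.neg).neg
    rwa [neg_add, neg_neg] at this

namespace CentralGrading

variable {n : ℕ} {R : Type*} [Ring R] (D : CentralGrading n R) {k l : ℕ}

/-- The products `a * (b * c - c * b) * d` of homogeneous elements, of total degree `k`. -/
def commutatorSet (k : ℕ) : Set R :=
  {z | ∃ p q r s a b c d, a ∈ D.component p ∧ b ∈ D.component q ∧ c ∈ D.component r ∧
    d ∈ D.component s ∧ p + (q + r) + s = k ∧ z = a * (b * c - c * b) * d}

variable {D}

theorem mem_component_of_mem_commutatorSet {z : R} (hz : z ∈ D.commutatorSet k) :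
    z ∈ D.component k := by
  obtain ⟨p, q, r, s, a, b, c, d, ha, hb, hc, hd, rfl, rfl⟩ := hz
  exact D.mul_mem (D.mul_mem ha
    (sub_mem (D.mul_mem hb hc) (add_comm r q ▸ D.mul_mem hc hb))) hd

theorem mul_mem_commutatorSet {z w : R} (hz : z ∈ D.commutatorSet k) (hw : w ∈ D.component l) :
    z * w ∈ D.commutatorSet (k + l) := by
  obtain ⟨p, q, r, s, a, b, c, d, ha, hb, hc, hd, rfl, rfl⟩ := hz
  exact ⟨p, q, r, s + l, a, b, c, d * w, ha, hb, hc, D.mul_mem hd hw, by ring,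
    by rw [mul_assoc _ d]⟩

theorem isNilpotent_of_mem_commutatorSet (hn : 0 < n) (hk : n ∣ k) {z : R}
    (hz : z ∈ D.commutatorSet k) : IsNilpotent z := by
  refine isNilpotent_of_centerExtend_eq_zero
    (D.mem_center hk (mem_component_of_mem_commutatorSet hz)) fun F _ φ ↦ ?_
  obtain ⟨p, q, r, s, a, b, c, d, ha, hb, hc, hd, rfl, rfl⟩ := hz
  have hbcd := D.mul_mem (D.mul_mem hb hc) hd
  have hcbd := D.mul_mem (D.mul_mem hc hb) hd
  have hk' : n ∣ p + (q + r + s) := by rwa [← add_assoc]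
  have hk'' : n ∣ p + (r + q + s) := by rwa [add_comm r q]
  have hsplit : a * (b * c - c * b) * d = a * (b * c * d) - a * (c * b * d) := by noncomm_ring
  rw [hsplit, centerExtend_sub φ (D.mem_center hk' (D.mul_mem ha hbcd))
      (D.mem_center hk'' (D.mul_mem ha hcbd)),
    D.centerExtend_mul_comm φ ha hbcd hk', D.centerExtend_mul_comm φ ha hcbd hk'',
    mul_assoc _ d, mul_assoc _ d, sub_eq_zero]
  exact D.centerExtend_swap φ hn hb hc (D.mul_mem hd ha) (by convert hk using 1; ring)

theorem list_prod_mem_component {deg : R → ℕ} {t : List R}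
    (h : ∀ z ∈ t, z ∈ D.component (deg z)) : t.prod ∈ D.component (t.map deg).sum := by
  induction t with
  | nil => simpa using D.one_mem
  | cons z t ih =>
    rw [List.prod_cons, List.map_cons, List.sum_cons]
    exact D.mul_mem (h z List.mem_cons_self) (ih fun w hw ↦ h w (List.mem_cons_of_mem z hw))

theorem list_prod_mem_commutatorSet {deg : R → ℕ} {t : List R} (ht : t ≠ [])
    (h : ∀ z ∈ t, z ∈ D.commutatorSet (deg z)) :
    t.prod ∈ D.commutatorSet (t.map deg).sum := by
  cases t with
  | nil => exact absurd rfl ht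
  | cons z t =>
    rw [List.prod_cons, List.map_cons, List.sum_cons]
    exact mul_mem_commutatorSet (h z List.mem_cons_self) (list_prod_mem_component fun w hw ↦
      mem_component_of_mem_commutatorSet (h w (List.mem_cons_of_mem z hw)))

end CentralGrading

theorem List.exists_append_dvd_sum {n : ℕ} (hn : 0 < n) {α : Type*} (deg : α → ℕ) {t : List α}
    (ht : n ≤ t.length) :
    ∃ t₁ t₂ t₃, t = t₁ ++ t₂ ++ t₃ ∧ t₂ ≠ [] ∧ n ∣ (t₂.map deg).sum := by
  obtain ⟨i, hi, j, hj, hij, h⟩ := Finset.exists_ne_map_eq_of_card_lt_of_maps_to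
    (s := Finset.range (n + 1)) (t := Finset.range n) (by simp)
    (f := fun m ↦ ((t.take m).map deg).sum % n)
    (fun m _ ↦ by simpa using Nat.mod_lt _ hn)
  wlog hlt : i < j generalizing i j
  · exact this j hj i hi hij.symm h.symm (by omega)
  have hj' : j ≤ n := Finset.mem_range_succ_iff.mp hj
  have htake : t.take j = t.take i ++ (t.take j).drop i := by
    conv_lhs => rw [← List.take_append_drop i (t.take j), List.take_take, min_eq_left hlt.le]
  refine ⟨t.take i, (t.take j).drop i, t.drop j, ?_, ?_, ?_⟩
  · rw [← htake, List.take_append_drop]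
  · refine List.ne_nil_of_length_pos ?_
    rw [List.length_drop, List.length_take]
    omega
  · have h' : ((t.take i).map deg).sum ≡ ((t.take j).map deg).sum [MOD n] := h
    rw [htake, List.map_append, List.sum_append] at h'
    exact (Nat.modEq_zero_iff_dvd.mp (Nat.ModEq.add_left_cancel' ((t.take i).map deg).sum h'.symm))

theorem CentralGrading.isNilpotent_of_mem_span_commutatorSet {n : ℕ} {R : Type*} [Ring R]
    {D : CentralGrading n R} (hn : 0 < n) {x : R}
    (hx : x ∈ Submodule.span ℤ (⋃ k, D.commutatorSet k)) : IsNilpotent x := by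
  refine IsNilpotent.of_pow (m := n) ?_
  have hxn := Submodule.pow_mem_pow _ hx n
  rw [Submodule.span_pow, ← Submodule.mem_toAddSubgroup,
    Submodule.span_int_eq_addSubgroupClosure] at hxn
  refine isNilpotent_of_mem_closure_center_nilpotent_mul (AddSubgroup.closure_mono ?_ hxn)
  intro y hy
  obtain ⟨f, rfl⟩ := Set.mem_pow.mp hy
  have hdeg : ∀ z : R, ∃ k, z ∈ ⋃ k, D.commutatorSet k → z ∈ D.commutatorSet k := by
    intro z
    by_cases hz : z ∈ ⋃ k, D.commutatorSet k
    · exact (Set.mem_iUnion.mp hz).imp fun k hk _ ↦ hk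
    · exact ⟨0, fun h ↦ absurd h hz⟩
  choose deg hdeg using hdeg
  have hmem : ∀ z ∈ List.ofFn fun i ↦ (f i : R), z ∈ D.commutatorSet (deg z) := by
    intro z hz
    obtain ⟨i, rfl⟩ := List.mem_ofFn.mp hz
    exact hdeg _ (f i).2
  obtain ⟨t₁, t₂, t₃, ht, hne, hdvd⟩ := List.exists_append_dvd_sum hn deg
    (t := List.ofFn fun i ↦ (f i : R)) (by simp)
  rw [ht] at hmem ⊢
  have hz := list_prod_mem_commutatorSet hne fun z hz ↦ hmem z (by simp [hz])
  have hc := D.mem_center hdvd (mem_component_of_mem_commutatorSet hz)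
  refine ⟨t₂.prod, t₁.prod * t₃.prod, isNilpotent_of_mem_commutatorSet hn hdvd hz, hc, ?_⟩
  rw [List.prod_append, List.prod_append, Subring.mem_center_iff.mp hc, mul_assoc]

section RootOfUnity

variable {S A : Type*} [CommRing S] [Ring A] [Algebra S A]

/-- The component of `z` on which `f` acts as `ζ⁻¹ ^ i`, scaled by `n`. -/
def eigenComponent (n : ℕ) (ζ : S) (f : A →ₐ[S] A) (i : ℕ) (z : A) : A :=
  ∑ k ∈ Finset.range n, ζ ^ (i * k) • (f ^ k) z

theorem map_eigenComponent {n : ℕ} (hn : 0 < n) {ζ : S} (hζ : ζ ^ n = 1) {f : A →ₐ[S] A}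
    (hf : f ^ n = 1) (i : ℕ) (z : A) :
    f (eigenComponent n ζ f i z) = ζ ^ ((n - 1) * i) • eigenComponent n ζ f i z := by
  have hshift : ∑ k ∈ Finset.range n, ζ ^ (i * (k + 1)) • (f ^ (k + 1)) z =
      eigenComponent n ζ f i z := by
    have h₁ := Finset.sum_range_succ (fun k ↦ ζ ^ (i * k) • (f ^ k) z) n
    have h₂ := Finset.sum_range_succ' (fun k ↦ ζ ^ (i * k) • (f ^ k) z) n
    rw [h₁, hf, mul_comm i n, pow_mul, hζ, one_pow] at h₂
    simpa [eigenComponent] using h₂.symm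
  conv_rhs => rw [← hshift]
  rw [eigenComponent, map_sum, Finset.smul_sum]
  refine Finset.sum_congr rfl fun k _ ↦ ?_
  have hexp : (n - 1) * i + i * (k + 1) = n * i + i * k := by
    obtain ⟨m, rfl⟩ : ∃ m, n = m + 1 := ⟨n - 1, by omega⟩
    rw [Nat.add_sub_cancel]; ring
  rw [map_smul, smul_smul, ← pow_add, hexp, pow_add, pow_mul ζ n, hζ, one_pow, one_mul, pow_succ']
  rfl

theorem sum_eigenComponent [IsDomain S] {n : ℕ} (hn : 0 < n) {ζ : S} (hζ : IsPrimitiveRoot ζ n)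
    (f : A →ₐ[S] A) (z : A) :
    ∑ i ∈ Finset.range n, eigenComponent n ζ f i z = n • z := by
  simp only [eigenComponent]
  rw [Finset.sum_comm, Finset.sum_eq_single_of_mem 0 (Finset.mem_range.mpr hn)]
  · simp
  · intro k hk hk0
    rw [← Finset.sum_smul]
    have hne : ζ ^ k - 1 ≠ 0 :=
      sub_ne_zero.mpr (hζ.pow_ne_one_of_pos_of_lt hk0 (Finset.mem_range.mp hk))
    have hsum : (ζ ^ k - 1) * ∑ i ∈ Finset.range n, (ζ ^ k) ^ i = 0 := by
      rw [mul_geom_sum, ← pow_mul, mul_comm k, pow_mul, hζ.pow_eq_one, one_pow, sub_self]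
    have := (mul_eq_zero.mp hsum).resolve_left hne
    simp only [← pow_mul] at this
    simp only [mul_comm _ k, this, zero_smul]

/-- The eigenspaces of an algebra endomorphism for the powers of an `n`-th root of unity, when
the fixed elements are central. -/
def eigenGrading {n : ℕ} {ζ : S} (hζ : ζ ^ n = 1) (f : A →ₐ[S] A)
    (hf : ∀ z, f z = z → z ∈ Subring.center A) : CentralGrading n A where
  component k :=
    { carrier := {z | f z = ζ ^ k • z}
      add_mem' := fun {x y} hx hy ↦ by
        rw [Set.mem_ofPred_eq] at *; rw [map_add, hx, hy, smul_add]
      zero_mem' := by simp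
      neg_mem' := fun {x} hx ↦ by
        rw [Set.mem_ofPred_eq] at *; rw [map_neg, hx, smul_neg] }
  mul_mem {i j x y} hx hy := by
    change f (x * y) = ζ ^ (i + j) • (x * y)
    rw [map_mul, show f x = ζ ^ i • x from hx, show f y = ζ ^ j • y from hy, smul_mul_smul_comm,
      pow_add]
  one_mem := by change f 1 = ζ ^ 0 • 1; simp
  mem_center := by
    rintro _ x ⟨m, rfl⟩ hx
    refine hf x ?_
    rw [show f x = ζ ^ (n * m) • x from hx, pow_mul, hζ, one_pow, one_smul]

theorem nsmul_commutator_mem_span_commutatorSet [IsDomain S] {n : ℕ} (hn : 0 < n) {ζ : S}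
    (hζ : IsPrimitiveRoot ζ n) {f : A →ₐ[S] A} (hfn : f ^ n = 1)
    (hf : ∀ z, f z = z → z ∈ Subring.center A) (a b c d : A) :
    n ^ 4 • (a * (b * c - c * b) * d) ∈
      Submodule.span ℤ (⋃ k, (eigenGrading hζ.pow_eq_one f hf).commutatorSet k) := by
  have h : n ^ 4 • (a * (b * c - c * b) * d) =
      (n • a) * ((n • b) * (n • c) - (n • c) * (n • b)) * (n • d) := by
    simp only [smul_mul_assoc, mul_smul_comm, ← smul_sub, smul_smul]
    congr 1; ring
  have hbr (u v : ℕ → A) (s : Finset ℕ) : (∑ i ∈ s, u i) * (∑ j ∈ s, v j) -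
      (∑ j ∈ s, v j) * (∑ i ∈ s, u i) = ∑ i ∈ s, ∑ j ∈ s, (u i * v j - v j * u i) := by
    simp only [Finset.sum_sub_distrib, Finset.sum_mul_sum]
    rw [Finset.sum_comm (f := fun i j ↦ v j * u i)]
  rw [h, ← sum_eigenComponent hn hζ f a, ← sum_eigenComponent hn hζ f b,
    ← sum_eigenComponent hn hζ f c, ← sum_eigenComponent hn hζ f d, hbr]
  simp only [Finset.sum_mul, Finset.mul_sum]
  have hmem (i : ℕ) (z : A) : eigenComponent n ζ f i z ∈
      (eigenGrading hζ.pow_eq_one f hf).component ((n - 1) * i) :=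
    map_eigenComponent hn hζ.pow_eq_one hfn i z
  refine sum_mem fun _ _ ↦ sum_mem fun _ _ ↦ sum_mem fun _ _ ↦ sum_mem fun _ _ ↦ ?_
  exact Submodule.subset_span (Set.mem_iUnion.mpr
    ⟨_, _, _, _, _, _, _, _, _, hmem _ _, hmem _ _, hmem _ _, hmem _ _, rfl, rfl⟩)

end RootOfUnity

open scoped TensorProduct NumberField

theorem baseChange_eq_zero_of_nsmul {S R : Type*} [CommRing S] [Module.Flat ℤ S] [Ring R] {n : ℕ}
    (htor : ∀ x : R, n • x = 0 → x = 0) {z : S ⊗[ℤ] R} (hz : n • z = 0) : z = 0 := by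
  have hreg : IsSMulRegular R (n : ℤ) := by
    refine (isSMulRegular_iff_right_eq_zero_of_smul).mpr fun x hx ↦ htor x ?_
    rwa [natCast_zsmul] at hx
  refine isSMulRegular_iff_right_eq_zero_of_smul.mp (hreg.lTensor S) z ?_
  rwa [natCast_zsmul]

section BaseChange

variable {R : Type*} [Ring R] (S : Type*) [CommRing S] (α : RingAut R)

/-- The extension of scalars of a ring automorphism. -/
noncomputable def RingAut.baseChange : S ⊗[ℤ] R →ₐ[S] S ⊗[ℤ] R :=
  Algebra.TensorProduct.map (AlgHom.id S S) (α : R →+* R).toIntAlgHom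

theorem RingAut.baseChange_pow_tmul (m : ℕ) (s : S) (r : R) :
    (RingAut.baseChange S α ^ m) (s ⊗ₜ r) = s ⊗ₜ (α ^ m) r := by
  induction m with
  | zero => rfl
  | succ m ih =>
    rw [pow_succ', AlgHom.mul_apply, ih, pow_succ']
    rfl

theorem RingAut.baseChange_pow_eq_one {n : ℕ} (hα : α ^ n = 1) :
    RingAut.baseChange S α ^ n = 1 := by
  ext r
  simpa [hα] using RingAut.baseChange_pow_tmul S α n 1 r

theorem RingAut.map_sum_pow {n : ℕ} (hα : α ^ n = 1) (r : R) :
    α (∑ k ∈ Finset.range n, (α ^ k) r) = ∑ k ∈ Finset.range n, (α ^ k) r := by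
  have h₁ := Finset.sum_range_succ (fun k ↦ (α ^ k) r) n
  rw [Finset.sum_range_succ', hα] at h₁
  rw [map_sum]
  simpa [pow_succ'] using h₁

variable {S α}

theorem RingAut.sum_baseChange_pow_mem_center {n : ℕ} (hα : α ^ n = 1)
    (hfix : ∀ x : R, α x = x → ∀ y : R, x * y = y * x) (z : S ⊗[ℤ] R) :
    ∑ k ∈ Finset.range n, (RingAut.baseChange S α ^ k) z ∈ Subring.center (S ⊗[ℤ] R) := by
  induction z with
  | zero => simp
  | add z w hz hw => simpa only [map_add, Finset.sum_add_distrib] using add_mem hz hw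
  | tmul s r =>
    simp only [RingAut.baseChange_pow_tmul, ← TensorProduct.tmul_sum]
    refine Subring.mem_center_iff.mpr fun w ↦ ?_
    induction w with
    | zero => simp
    | add w w' h h' => rw [add_mul, mul_add, h, h']
    | tmul s' r' =>
      rw [Algebra.TensorProduct.tmul_mul_tmul, Algebra.TensorProduct.tmul_mul_tmul, mul_comm s',
        hfix _ (RingAut.map_sum_pow α hα r)]

theorem RingAut.mem_center_of_baseChange_fixed [Module.Flat ℤ S] {n : ℕ} (hα : α ^ n = 1)
    (hfix : ∀ x : R, α x = x → ∀ y : R, x * y = y * x) (htor : ∀ x : R, n • x = 0 → x = 0)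
    (z : S ⊗[ℤ] R) (hz : RingAut.baseChange S α z = z) : z ∈ Subring.center (S ⊗[ℤ] R) := by
  have hsum : ∑ k ∈ Finset.range n, (RingAut.baseChange S α ^ k) z = n • z := by
    have hpow : ∀ k, (RingAut.baseChange S α ^ k) z = z := by
      intro k
      induction k with
      | zero => rfl
      | succ k ih => rw [pow_succ, AlgHom.mul_apply, hz, ih]
    simp [hpow]
  have hc := hsum ▸ RingAut.sum_baseChange_pow_mem_center (S := S) hα hfix z
  refine Subring.mem_center_iff.mpr fun w ↦ sub_eq_zero.mp (baseChange_eq_zero_of_nsmul htor ?_)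
  rw [smul_sub, ← mul_smul_comm, ← smul_mul_assoc, Subring.mem_center_iff.mp hc w, sub_self]

end BaseChange


/-- Let `R` be a ring, `n` a positive integer, and `α` an automorphism of `R` with
`α ^ n = 1`, such that every element fixed by `α` is central, and such that `R`
has no `n`-torsion.  Then the commutator ideal of `R` (the two-sided ideal
generated by all `a * b - b * a`) is nil. -/
theorem commutator_ideal_nil_of_central_fixed_ring
    {R : Type*} [Ring R] {n : ℕ} (hn : 0 < n) (α : RingAut R)
    (hα : α ^ n = 1)
    (hfix : ∀ x : R, α x = x → ∀ y : R, x * y = y * x)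
    (htor : ∀ x : R, n • x = 0 → x = 0) :
    ∀ x ∈ TwoSidedIdeal.span {z : R | ∃ a b : R, z = a * b - b * a},
      IsNilpotent x := by
  intro x hx
  have : NeZero n := ⟨hn.ne'⟩
  let S := 𝓞 (CyclotomicField n ℚ)
  have : IsCyclotomicExtension {n} ℚ (CyclotomicField n ℚ) :=
    CyclotomicField.isCyclotomicExtension n ℚ
  have hζ := (IsCyclotomicExtension.zeta_spec n ℚ
    (CyclotomicField n ℚ)).toInteger_isPrimitiveRoot
  have hf := RingAut.mem_center_of_baseChange_fixed (S := S) hα hfix htor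
  let ι : R →+* S ⊗[ℤ] R :=
    (Algebra.TensorProduct.includeRight : R →ₐ[ℤ] S ⊗[ℤ] R).toRingHom
  have hι : Function.Injective ι := Module.FaithfullyFlat.tensorProduct_mk_injective R
  have hmem : n ^ 4 • ι x ∈ Submodule.span ℤ
      (⋃ k, (eigenGrading hζ.pow_eq_one (RingAut.baseChange S α) hf).commutatorSet k) := by
    rw [TwoSidedIdeal.mem_span_iff_mem_addSubgroup_closure] at hx
    induction hx using AddSubgroup.closure_induction with
    | mem x hx =>
      obtain ⟨_, ⟨a, -, _, ⟨b, c, rfl⟩, rfl⟩, d, -, rfl⟩ := hx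
      have := nsmul_commutator_mem_span_commutatorSet hn hζ
        (RingAut.baseChange_pow_eq_one S α hα) hf (ι a) (ι b) (ι c) (ι d)
      simpa only [map_mul, map_sub] using this
    | zero => rw [map_zero, smul_zero]; exact zero_mem _
    | add x y _ _ hx hy => rw [map_add, smul_add]; exact add_mem hx hy
    | neg x _ hx => rw [map_neg, smul_neg]; exact neg_mem hx
  obtain ⟨m, hm⟩ := CentralGrading.isNilpotent_of_mem_span_commutatorSet hn hmem
  refine ⟨m, ?_⟩
  rw [← map_nsmul, ← map_pow, map_eq_zero_iff ι hι, smul_pow, ← pow_mul] at hm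
  generalize x ^ m = y at hm ⊢
  generalize 4 * m = e at hm
  induction e with
  | zero => simpa using hm
  | succ e ih => exact ih (htor _ (by rwa [smul_smul, ← pow_succ']))
end

section
/- The group ℤ^ω (the direct product of countably many copies of the integers) has a subgroup H whose dual group Hom(H, ℤ) is free abelian of rank 2^ℵ₀, i.e., Hom(H, ℤ) is isomorphic to a free abelian group on a set of cardinality 2^ℵ₀. -/
open Filter

namespace DualFree

/-- The subgroup `M` of `ℤ^Y` consists of the functions supported in members of a tall ideal of
countable subsets of `Y` that contains all singletons. -/
structure IsThick {Y : Type*} (M : AddSubgroup (Y → ℤ)) : Prop where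
  solid : ∀ g ∈ M, ∀ f : Y → ℤ, f.support ⊆ g.support → f ∈ M
  countable : ∀ f ∈ M, f.support.Countable
  tall : ∀ T : Set Y, T.Infinite → ∃ f ∈ M, f.support ⊆ T ∧ f.support.Infinite
  indicator_singleton_mem : ∀ y, Set.indicator {y} 1 ∈ M

lemma exists_map_single_eq_zero (φ : (ℕ → ℤ) →+ ℤ) : ∃ n, φ (Pi.single n 1) = 0 := by
  classical
  let c : ℕ → ℤ := fun n => ∏ i ∈ Finset.range n, (|φ (Pi.single i 1)| + 1)
  have hc0 (n) : c n ≠ 0 := Finset.prod_ne_zero_iff.2 fun i _ => by positivity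
  have hcs (n) : c (n + 1) = c n * (|φ (Pi.single n 1)| + 1) := Finset.prod_range_succ _ _
  have hcd {m n} (h : m ≤ n) : c m ∣ c n :=
    Finset.prod_dvd_prod_of_subset _ _ _ (Finset.range_mono h)
  have hni := Function.cantor_injective fun ε : Set ℕ => Encodable.encode (φ (ε.indicator c))
  obtain ⟨ε, δ, hφ, hne⟩ : ∃ ε δ : Set ℕ, φ (ε.indicator c) = φ (δ.indicator c) ∧ ε ≠ δ := by
    simpa [Function.Injective] using hni
  have hex : ∃ n, ¬ (n ∈ ε ↔ n ∈ δ) := by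
    by_contra! h
    exact hne (Set.ext h)
  let n := Nat.find hex
  have hn : ¬ (n ∈ ε ↔ n ∈ δ) := Nat.find_spec hex
  have hlt (m) (hm : m < n) : m ∈ ε ↔ m ∈ δ := not_not.1 (Nat.find_min hex hm)
  let u := ε.indicator c - δ.indicator c
  have hu0 : φ u = 0 := by simp [u, hφ]
  have hud (m) (hm : m ≠ n) : c (n + 1) ∣ u m := by
    rcases lt_or_gt_of_ne hm with h | h
    · have := hlt m h
      by_cases h' : m ∈ ε <;> simp_all [u]
    · exact dvd_sub (by by_cases h' : m ∈ ε <;> simp [h', hcd (Nat.succ_le_of_lt h)])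
        (by by_cases h' : m ∈ δ <;> simp [h', hcd (Nat.succ_le_of_lt h)])
  have hun : u n = c n ∨ u n = - c n := by
    by_cases h1 : n ∈ ε <;> by_cases h2 : n ∈ δ <;> simp_all [u]
  choose! v hv using hud
  have hdec : u = u n • Pi.single n 1 + c (n + 1) • Function.update v n 0 := by
    ext m
    by_cases h : m = n
    · subst h; simp
    · simp [h, hv m h]
  have key : c (n + 1) ∣ u n * φ (Pi.single n 1) := by
    rw [hdec, map_add, map_zsmul, map_zsmul, smul_eq_mul, smul_eq_mul] at hu0
    exact ⟨- φ (Function.update v n 0), by linarith⟩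
  have key' : c (n + 1) ∣ c n * φ (Pi.single n 1) := by
    rcases hun with h | h <;> simpa [h] using key
  rw [hcs, mul_dvd_mul_iff_left (hc0 n)] at key'
  exact ⟨n, Int.eq_zero_of_abs_lt_dvd key' (by linarith)⟩

section Thick

variable {Y : Type*} {M : AddSubgroup (Y → ℤ)}

/-- Evaluation at a point, as a functional on a group of functions. -/
def eval (M : AddSubgroup (Y → ℤ)) (y : Y) : M →+ ℤ := (Pi.evalAddMonoidHom _ y).comp M.subtype

@[simp] lemma eval_apply (y : Y) (f : M) : eval M y f = f.1 y := rfl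

/-- The characteristic function of a point, as an element of a thick group. -/
noncomputable def delta (hM : IsThick M) (y : Y) : M := ⟨_, hM.indicator_singleton_mem y⟩

lemma finite_map_delta_ne_zero (hM : IsThick M) (φ : M →+ ℤ) :
    {y | φ (delta hM y) ≠ 0}.Finite := by
  classical
  by_contra hT
  obtain ⟨g, hg, hgT, hgi⟩ := hM.tall _ hT
  let s := hgi.natEmbedding
  have hs : Function.Injective fun n => (s n : Y) := Subtype.val_injective.comp s.injective
  have hmem (a : ℕ → ℤ) : Function.extend (fun n => (s n : Y)) a 0 ∈ M := by
    refine hM.solid g hg _ fun y hy => ?_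
    by_cases h : ∃ n, (s n : Y) = y
    · obtain ⟨n, rfl⟩ := h
      exact (s n).2
    · exact absurd (Function.extend_apply' _ _ _ h) hy
  let ext : (ℕ → ℤ) →+ M :=
    { toFun := fun a => ⟨_, hmem a⟩
      map_zero' := Subtype.ext (Function.extend_zero _)
      map_add' := fun a b => Subtype.ext (by
        simpa using Function.extend_add (fun n => (s n : Y)) a b (0 : Y → ℤ) 0) }
  obtain ⟨n, hn⟩ := exists_map_single_eq_zero (φ.comp ext)
  have : ext (Pi.single n 1) = delta hM (s n) := by
    refine Subtype.ext (funext fun y => ?_)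
    change Function.extend (fun n => (s n : Y)) (Pi.single n 1) (0 : Y → ℤ) y =
      Set.indicator {(s n : Y)} (1 : Y → ℤ) y
    by_cases h : ∃ m, (s m : Y) = y
    · obtain ⟨m, rfl⟩ := h
      rw [hs.extend_apply]
      by_cases hm : m = n
      · subst hm; simp
      · have : (s m : Y) ≠ s n := fun h => hm (hs h)
        simp [hm, this]
    · rw [Function.extend_apply' _ _ _ h]
      have : y ≠ s n := fun h' => h ⟨n, h'.symm⟩
      simp [this]
  rw [AddMonoidHom.comp_apply, this] at hn
  exact hgT (s n).2 hn

lemma eq_zero_of_forall_pow_dvd {p a : ℤ} (hp : 2 ≤ p) (h : ∀ n, p ^ n ∣ a) : a = 0 := by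
  refine Int.eq_zero_of_abs_lt_dvd (h a.natAbs) ?_
  calc |a| = (a.natAbs : ℤ) := Int.abs_eq_natAbs a
    _ < 2 ^ a.natAbs := by exact_mod_cast Nat.lt_two_pow_self
    _ ≤ p ^ a.natAbs := pow_le_pow_left₀ (by norm_num) hp _

lemma map_eq_zero_of_pow_dvd (hM : IsThick M) (φ : M →+ ℤ) (hφ : ∀ y, φ (delta hM y) = 0)
    {p : ℤ} (hp : 2 ≤ p) (u : M) (e : Y → ℕ) (he : Set.InjOn e u.1.support)
    (hu : ∀ y, p ^ e y ∣ u.1 y) : φ u = 0 := by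
  classical
  refine eq_zero_of_forall_pow_dvd hp fun n => ?_
  have hfin : {y ∈ u.1.support | e y < n}.Finite :=
    Set.Finite.of_finite_image ((Set.finite_lt_nat n).subset (by rintro _ ⟨y, hy, rfl⟩; exact hy.2))
      (he.mono fun y hy => hy.1)
  let S := hfin.toFinset
  let v : Y → ℤ := fun y => if y ∈ S then 0 else u.1 y / p ^ n
  have hv : v ∈ M := hM.solid u.1 u.2 _ fun y hy => by
    rw [Function.mem_support] at hy ⊢
    contrapose! hy
    simp [v, hy]
  have hdec : u = ∑ y ∈ S, u.1 y • delta hM y + p ^ n • (⟨v, hv⟩ : M) := by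
    refine Subtype.ext (funext fun y => ?_)
    have h1 : (∑ z ∈ S, u.1 z • delta hM z : M).1 y = if y ∈ S then u.1 y else 0 := by
      simp [delta, Pi.single_apply]
    have h2 : (∑ z ∈ S, u.1 z • delta hM z + p ^ n • (⟨v, hv⟩ : M) : M).1 y
      = (∑ z ∈ S, u.1 z • delta hM z : M).1 y + p ^ n * v y := by simp
    rw [h2, h1]
    by_cases hy : y ∈ S
    · simp [hy, v]
    · simp only [hy, if_false, v, zero_add]
      refine (Int.mul_ediv_cancel' ?_).symm
      by_cases h0 : u.1 y = 0
      · simp [h0]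
      · have : n ≤ e y := by
          by_contra! h
          exact hy (hfin.mem_toFinset.2 ⟨h0, h⟩)
        exact (pow_dvd_pow p this).trans (hu y)
  rw [hdec]
  simp [hφ]

lemma eq_zero_of_map_delta (hM : IsThick M) (φ : M →+ ℤ) (hφ : ∀ y, φ (delta hM y) = 0) :
    φ = 0 := by
  ext f
  obtain ⟨e, he⟩ := Set.countable_iff_exists_injOn.1 (hM.countable f.1 f.2)
  have hco (n : ℕ) : ∃ a b : ℤ, a * 2 ^ n + b * 3 ^ n = 1 :=
    (show IsCoprime (2 : ℤ) 3 from ⟨-1, 1, by norm_num⟩).pow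
  choose a b hab using hco
  have hmem (p : ℤ) (a : ℕ → ℤ) : (fun y => p ^ e y * (a (e y) * f.1 y)) ∈ M :=
    hM.solid f.1 f.2 _ fun y hy => by
      rw [Function.mem_support] at hy ⊢
      contrapose! hy
      simp [hy]
  have hz (p : ℤ) (hp : 2 ≤ p) (a : ℕ → ℤ) : φ ⟨_, hmem p a⟩ = 0 := by
    refine map_eq_zero_of_pow_dvd hM φ hφ hp _ e (he.mono fun y hy => ?_)
      fun y => Dvd.intro _ rfl
    rw [Function.mem_support] at hy ⊢
    contrapose! hy
    simp [hy]
  have : f = ⟨_, hmem 2 a⟩ + ⟨_, hmem 3 b⟩ := by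
    refine Subtype.ext (funext fun y => ?_)
    change f.1 y = 2 ^ e y * (a (e y) * f.1 y) + 3 ^ e y * (b (e y) * f.1 y)
    linear_combination - f.1 y * hab (e y)
  rw [this, map_add, hz 2 le_rfl, hz 3 (by norm_num)]
  simp

/-- Every functional on a thick group is a finite linear combination of evaluations. -/
lemma exists_linearCombination_eval (hM : IsThick M) (φ : M →+ ℤ) :
    ∃ c : Y →₀ ℤ, φ = Finsupp.linearCombination ℤ (eval M) c := by
  classical
  let c : Y →₀ ℤ := Finsupp.ofSupportFinite (fun y => φ (delta hM y))
    (finite_map_delta_ne_zero hM φ)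
  refine ⟨c, sub_eq_zero.1 (eq_zero_of_map_delta hM _ fun y => ?_)⟩
  have : Finsupp.linearCombination ℤ (eval M) c (delta hM y) = c y := by
    rw [Finsupp.linearCombination_apply, Finsupp.sum, AddMonoidHom.finsetSum_apply]
    simp only [AddMonoidHom.smul_apply, eval_apply, delta, Set.indicator_apply,
      Set.mem_singleton_iff, Pi.one_apply]
    simp +contextual [eq_comm]
  rw [AddMonoidHom.sub_apply, this]
  exact sub_self _

end Thick

section Extension

variable {Y X : Type*} (Γ : AddSubgroup ((Y → ℤ) × (X → ℤ)))

/-- The coordinate functionals on a group of pairs of functions. -/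
def coord : Y ⊕ X → (Γ →+ ℤ)
  | .inl y => ((Pi.evalAddMonoidHom _ y).comp (AddMonoidHom.fst _ _)).comp Γ.subtype
  | .inr x => ((Pi.evalAddMonoidHom _ x).comp (AddMonoidHom.snd _ _)).comp Γ.subtype

variable {Γ}

@[simp] lemma coord_inl (y : Y) (γ : Γ) : coord Γ (.inl y) γ = γ.1.1 y := rfl

@[simp] lemma coord_inr (x : X) (γ : Γ) : coord Γ (.inr x) γ = γ.1.2 x := rfl

lemma linearCombination_coord_apply (l : Y ⊕ X →₀ ℤ) (γ : Γ) :
    Finsupp.linearCombination ℤ (coord Γ) l γ = l.sum fun b a => a * coord Γ b γ := by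
  rw [Finsupp.linearCombination_apply, Finsupp.sum, AddMonoidHom.finsetSum_apply]
  rfl

lemma linearIndependent_coord
    (hK : IsThick (Γ.comap (AddMonoidHom.inl (Y → ℤ) (X → ℤ))))
    (hG : IsThick (Γ.map (AddMonoidHom.snd (Y → ℤ) (X → ℤ)))) :
    LinearIndependent ℤ (coord Γ) := by
  classical
  rw [linearIndependent_iff]
  intro l hl
  have hl' (γ : Γ) : (l.sum fun b a => a * coord Γ b γ) = 0 := by
    rw [← linearCombination_coord_apply, hl]
    rfl
  have hY (y : Y) : l (.inl y) = 0 := by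
    have h := hl' ⟨_, hK.indicator_singleton_mem y⟩
    rw [Finsupp.sum, Finset.sum_eq_single (.inl y)] at h
    · simpa using h
    · rintro (z | z) - hz
      · have : z ≠ y := by simpa using hz
        simp [this]
      · simp
    · intro h
      simp [Finsupp.notMem_support_iff.1 h]
  ext (y | x)
  · exact hY y
  · obtain ⟨γ, hγ, hx⟩ := hG.indicator_singleton_mem x
    have hx' : γ.2 = Set.indicator {x} 1 := hx
    have h := hl' ⟨γ, hγ⟩
    rw [Finsupp.sum, Finset.sum_eq_single (.inr x)] at h
    · simpa [hx'] using h
    · rintro (z | z) - hz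
      · simp [hY]
      · have : z ≠ x := by simpa using hz
        simp [this, hx']
    · intro h
      simp [Finsupp.notMem_support_iff.1 h]

lemma span_coord
    (hK : IsThick (Γ.comap (AddMonoidHom.inl (Y → ℤ) (X → ℤ))))
    (hG : IsThick (Γ.map (AddMonoidHom.snd (Y → ℤ) (X → ℤ)))) :
    ⊤ ≤ Submodule.span ℤ (Set.range (coord Γ)) := by
  intro φ _
  let ι := (AddMonoidHom.inl (Y → ℤ) (X → ℤ)).addSubgroupComap Γ
  let π := (AddMonoidHom.snd (Y → ℤ) (X → ℤ)).addSubgroupMap Γ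
  have hπ : Function.Surjective π := AddMonoidHom.addSubgroupMap_surjective _ _
  obtain ⟨c, hc⟩ := exists_linearCombination_eval hK (φ.comp ι)
  let φ₁ : Γ →+ ℤ := Finsupp.linearCombination ℤ (fun y => coord Γ (.inl y)) c
  have hφ₁ : φ₁ ∈ Submodule.span ℤ (Set.range (coord Γ)) :=
    Submodule.span_mono (by rintro _ ⟨y, rfl⟩; exact ⟨_, rfl⟩)
      (Finsupp.mem_span_range_iff_exists_finsupp.2 ⟨c, rfl⟩)
  have hker : π.ker ≤ (φ - φ₁).ker := by
    rintro ⟨⟨f, g⟩, hγ⟩ h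
    have hg : g = 0 := congrArg Subtype.val (AddMonoidHom.mem_ker.1 h)
    subst hg
    have := DFunLike.congr_fun hc ⟨f, hγ⟩
    rw [AddMonoidHom.mem_ker, AddMonoidHom.sub_apply, sub_eq_zero]
    refine this.trans ?_
    simp only [φ₁, Finsupp.linearCombination_apply, Finsupp.sum, AddMonoidHom.finsetSum_apply]
    rfl
  let ψ := π.liftOfSurjective hπ ⟨φ - φ₁, hker⟩
  have hψ : ψ.comp π = φ - φ₁ := AddMonoidHom.liftOfRightInverse_comp π _ _ ⟨φ - φ₁, hker⟩
  obtain ⟨d, hd⟩ := exists_linearCombination_eval hG ψ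
  have hφ₂ : φ - φ₁ = Finsupp.linearCombination ℤ (fun x => coord Γ (.inr x)) d := by
    rw [← hψ, hd]
    ext γ
    simp only [Finsupp.linearCombination_apply, Finsupp.sum, AddMonoidHom.finsetSum_apply,
      AddMonoidHom.comp_apply]
    rfl
  have hφ₂' : φ - φ₁ ∈ Submodule.span ℤ (Set.range (coord Γ)) :=
    Submodule.span_mono (by rintro _ ⟨y, rfl⟩; exact ⟨_, rfl⟩)
      (Finsupp.mem_span_range_iff_exists_finsupp.2 ⟨d, hφ₂.symm⟩)
  simpa using add_mem hφ₂' hφ₁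

end Extension

/-- The integer functions with countable support on the power set of `ℕ`. -/
abbrev CountablySupported : Type := {g : Set ℕ → ℤ // g.support.Countable}

lemma exists_injective_code : ∃ code : CountablySupported → Set ℕ, Function.Injective code := by
  have h : Cardinal.mk CountablySupported ≤ Cardinal.mk (Set ℕ) := by
    calc Cardinal.mk CountablySupported
        ≤ Cardinal.mk {t : Set (Set ℕ × ℤ) // Cardinal.mk t ≤ Cardinal.aleph0} := by
          refine Cardinal.mk_le_of_injective
            (f := fun g => ⟨(fun x => (x, g.1 x)) '' g.1.support, ?_⟩) fun g g' h => ?_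
          · exact Cardinal.le_aleph0_iff_set_countable.2 (g.2.image _)
          · have h' := congrArg Subtype.val h
            have aux {g g' : Set ℕ → ℤ} (h : (fun x => (x, g x)) '' g.support =
                (fun x => (x, g' x)) '' g'.support) {x} (hx : g x ≠ 0) : g' x = g x := by
              have : (x, g x) ∈ (fun x => (x, g' x)) '' g'.support := h ▸ ⟨x, hx, rfl⟩
              obtain ⟨y, -, hy⟩ := this
              obtain ⟨rfl, h2⟩ := Prod.ext_iff.1 hy
              exact h2
            refine Subtype.ext (funext fun x => ?_)
            by_cases hx : g.1 x = 0
            · by_cases hx' : g'.1 x = 0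
              · rw [hx, hx']
              · exact aux h'.symm hx'
            · exact (aux h' hx).symm
      _ ≤ max (Cardinal.mk (Set ℕ × ℤ)) Cardinal.aleph0 ^ Cardinal.aleph0 :=
          Cardinal.mk_bounded_set_le _ _
      _ = Cardinal.mk (Set ℕ) := by simp [Cardinal.aleph0_le_continuum]
  obtain ⟨f⟩ := h
  exact ⟨f, f.injective⟩

/-- A code in `Set ℕ` for each countably supported function. -/
noncomputable def code : CountablySupported → Set ℕ := exists_injective_code.choose

lemma code_injective : Function.Injective code := exists_injective_code.choose_spec

/-- A countable set with an independent family of continuum many integer functions. -/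
abbrev Idx : Type := ℕ × (Finset ℕ →₀ ℤ)

open Classical in
/-- The part of the code of `g` below `n`. -/
noncomputable def cut (n : ℕ) (g : CountablySupported) : Finset ℕ :=
  {i ∈ Finset.range n | i ∈ code g}

/-- An independent family of functions on `Idx`. -/
noncomputable def indep (g : CountablySupported) (d : Idx) : ℤ := d.2 (cut d.1 g)

/-- The dual filter of the ideal `Fin ⊗ Fin` on `Idx`. -/
def baseFilter : Filter Idx := (atTop : Filter ℕ).curry cofinite

lemma eventually_injOn_cut (s : Finset CountablySupported) :
    ∀ᶠ n in atTop, Set.InjOn (cut n) (s : Set CountablySupported) := by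
  have (g g' : CountablySupported) (h : g ≠ g') : ∀ᶠ n in atTop, cut n g ≠ cut n g' := by
    obtain ⟨i, hi⟩ : ∃ i, ¬ (i ∈ code g ↔ i ∈ code g') := by
      by_contra! h'
      exact h (code_injective (Set.ext h'))
    filter_upwards [eventually_gt_atTop i] with n hn heq
    have := Finset.ext_iff.1 heq i
    simp only [cut, Finset.mem_filter, Finset.mem_range, hn, true_and] at this
    exact hi this
  have h2 : ∀ᶠ n in atTop, ∀ g ∈ s, ∀ g' ∈ s, g ≠ g' → cut n g ≠ cut n g' := by
    simp only [Finset.eventually_all]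
    intro g _ g' _
    by_cases h : g = g'
    · simp [h]
    · simpa [h] using this g g' h
  filter_upwards [h2] with n hn g hg g' hg' h
  by_contra hne
  exact hn g hg g' hg' hne h

lemma frequently_indep (s : Finset CountablySupported) (x : Set ℕ) :
    ∃ᶠ d in baseFilter, ∀ g ∈ s, indep g d = g.1 x := by
  rw [baseFilter, frequently_curry_iff]
  refine (eventually_injOn_cut s).frequently.mono fun n hn => ?_
  rw [frequently_cofinite_iff_infinite]
  let h₀ : Finset ℕ →₀ ℤ := ∑ g ∈ s, Finsupp.single (cut n g) (g.1 x)
  have h₀_apply (g) (hg : g ∈ s) : h₀ (cut n g) = g.1 x := by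
    simp only [h₀, Finsupp.finsetSum_apply]
    rw [Finset.sum_eq_single g]
    · simp
    · intro g' hg' hne
      exact Finsupp.single_eq_of_ne fun h => hne (hn hg' hg h.symm)
    · exact fun h => absurd hg h
  refine Set.infinite_of_injective_forall_mem (f := fun m : ℤ => h₀ + Finsupp.single {n} m)
    (fun m m' h => Finsupp.single_injective _ (add_left_cancel h)) fun m g hg => ?_
  have : cut n g ≠ {n} := fun h => by
    have : n ∈ cut n g := h ▸ Finset.mem_singleton_self n
    simp [cut] at this
  simp [indep, h₀_apply g hg, this]

/-- `f` has the constant value `k` on a set of the filter generated by `baseFilter` and the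
conditions `indep g = g x`. -/
def HasLim (x : Set ℕ) (f : Idx → ℤ) (k : ℤ) : Prop :=
  ∃ s : Finset CountablySupported, ∀ᶠ d in baseFilter, (∀ g ∈ s, indep g d = g.1 x) → f d = k

lemma HasLim.unique {x f k k'} (h : HasLim x f k) (h' : HasLim x f k') : k = k' := by
  classical
  obtain ⟨s, hs⟩ := h
  obtain ⟨s', hs'⟩ := h'
  obtain ⟨d, hd, h1, h2⟩ := ((frequently_indep (s ∪ s') x).and_eventually (hs.and hs')).exists
  rw [← h1 fun g hg => hd g (Finset.mem_union_left _ hg),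
    ← h2 fun g hg => hd g (Finset.mem_union_right _ hg)]

lemma HasLim.add {x f f' k k'} (h : HasLim x f k) (h' : HasLim x f' k') :
    HasLim x (f + f') (k + k') := by
  classical
  obtain ⟨s, hs⟩ := h
  obtain ⟨s', hs'⟩ := h'
  refine ⟨s ∪ s', ?_⟩
  filter_upwards [hs, hs'] with d h1 h2 hd
  rw [Pi.add_apply, h1 fun g hg => hd g (Finset.mem_union_left _ hg),
    h2 fun g hg => hd g (Finset.mem_union_right _ hg)]

lemma HasLim.neg {x f k} (h : HasLim x f k) : HasLim x (-f) (-k) := by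
  obtain ⟨s, hs⟩ := h
  refine ⟨s, ?_⟩
  filter_upwards [hs] with d h1 hd
  rw [Pi.neg_apply, h1 hd]

lemma HasLim.of_eventually {x f k} (h : ∀ᶠ d in baseFilter, f d = k) : HasLim x f k :=
  ⟨∅, by simpa using h⟩

lemma HasLim.of_support_subset {x} {f g : Idx → ℤ} (h : HasLim x g 0) (hfg : f.support ⊆ g.support) :
    HasLim x f 0 := by
  obtain ⟨s, hs⟩ := h
  refine ⟨s, ?_⟩
  filter_upwards [hs] with d h1 hd
  by_contra hf
  exact hfg hf (h1 hd)

lemma hasLim_indep (g : CountablySupported) (x : Set ℕ) : HasLim x (indep g) (g.1 x) :=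
  ⟨{g}, Eventually.of_forall fun _ hd => hd g (Finset.mem_singleton_self g)⟩

lemma HasLim.indicator_of_finite {x : Set ℕ} {T : Set Idx}
    (hT : ∀ᶠ n in atTop, {h | (n, h) ∈ T}.Finite) : HasLim x (T.indicator 1) 0 := by
  refine .of_eventually ?_
  rw [baseFilter, eventually_curry_iff]
  filter_upwards [hT] with n hn
  filter_upwards [hn.compl_mem_cofinite] with h hh
  exact Set.indicator_of_notMem (show (n, h) ∉ T from hh) (1 : Idx → ℤ)

/-- The pairs consisting of a function with limits and its countably supported limit function. -/
def limGroup : AddSubgroup ((Idx → ℤ) × (Set ℕ → ℤ)) where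
  carrier := {γ | γ.2.support.Countable ∧ ∀ x, HasLim x γ.1 (γ.2 x)}
  zero_mem' := ⟨by simp, fun x => .of_eventually (by simp)⟩
  add_mem' {γ γ'} h h' := ⟨(h.1.union h'.1).mono (Function.support_add _ _),
    fun x => (h.2 x).add (h'.2 x)⟩
  neg_mem' h := ⟨by simpa using h.1, fun x => (h.2 x).neg⟩

lemma mem_comap_limGroup {f : Idx → ℤ} :
    f ∈ limGroup.comap (AddMonoidHom.inl (Idx → ℤ) (Set ℕ → ℤ)) ↔ ∀ x, HasLim x f 0 := by
  refine ⟨And.right, fun h => ⟨?_, h⟩⟩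
  simp

lemma mem_map_limGroup {g : Set ℕ → ℤ} :
    g ∈ limGroup.map (AddMonoidHom.snd (Idx → ℤ) (Set ℕ → ℤ)) ↔ g.support.Countable := by
  constructor
  · rintro ⟨γ, hγ, rfl⟩
    exact hγ.1
  · intro hg
    exact ⟨(indep ⟨g, hg⟩, g), ⟨hg, hasLim_indep ⟨g, hg⟩⟩, rfl⟩

lemma isThick_comap_limGroup :
    IsThick (limGroup.comap (AddMonoidHom.inl (Idx → ℤ) (Set ℕ → ℤ))) where
  solid g hg f hfg := mem_comap_limGroup.2 fun x => (mem_comap_limGroup.1 hg x).of_support_subset hfg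
  countable f _ := Set.to_countable _
  tall T hT := by
    have hsupp (T : Set Idx) : (T.indicator (1 : Idx → ℤ)).support = T := by simp
    by_cases h : ∃ n, {h | (n, h) ∈ T}.Infinite
    · obtain ⟨n, hn⟩ := h
      refine ⟨((fun h => (n, h)) '' {h | (n, h) ∈ T}).indicator 1,
        mem_comap_limGroup.2 fun x => .indicator_of_finite ?_, ?_, ?_⟩
      · filter_upwards [eventually_gt_atTop n] with m hm
        have : {h | (m, h) ∈ (fun h => (n, h)) '' {h | (n, h) ∈ T}} = ∅ := by
          ext h
          simp [hm.ne]
        rw [this]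
        exact Set.finite_empty
      · rw [hsupp]
        rintro _ ⟨h, hh, rfl⟩
        exact hh
      · rw [hsupp]
        exact hn.image (Prod.mk_right_injective n).injOn
    · push Not at h
      exact ⟨T.indicator 1, mem_comap_limGroup.2 fun x => .indicator_of_finite (.of_forall h),
        (hsupp T).subset, by rwa [hsupp]⟩
  indicator_singleton_mem d := mem_comap_limGroup.2 fun x => .indicator_of_finite <|
    .of_forall fun n => (Set.finite_singleton d.2).subset fun h hh => congrArg Prod.snd hh

lemma isThick_map_limGroup :
    IsThick (limGroup.map (AddMonoidHom.snd (Idx → ℤ) (Set ℕ → ℤ))) where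
  solid g hg f hfg := mem_map_limGroup.2 ((mem_map_limGroup.1 hg).mono hfg)
  countable f hf := mem_map_limGroup.1 hf
  tall T hT := by
    let s := hT.natEmbedding
    have hsupp : ((Set.range fun n => (s n : Set ℕ)).indicator (1 : Set ℕ → ℤ)).support =
        Set.range fun n => (s n : Set ℕ) := by simp
    refine ⟨(Set.range fun n => (s n : Set ℕ)).indicator 1, mem_map_limGroup.2 ?_, ?_, ?_⟩ <;>
      rw [hsupp]
    · exact Set.countable_range _
    · rintro _ ⟨n, rfl⟩
      exact (s n).2
    · exact Set.infinite_range_of_injective (Subtype.val_injective.comp s.injective)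
  indicator_singleton_mem x := mem_map_limGroup.2 <|
    (Set.countable_singleton x).mono Set.support_indicator_subset

end DualFree

open DualFree in
/-- The group `ℤ^ω` of all integer sequences has a subgroup `H` whose dual group
`Hom(H, ℤ)` is free abelian of rank `2 ^ ℵ₀`, i.e. isomorphic to the free abelian
group on a set of cardinality `2 ^ ℵ₀` (the continuum). -/
theorem exists_subgroup_dual_free_abelian_of_rank_continuum :
    ∃ (H : AddSubgroup (ℕ → ℤ)) (B : Type),
      Cardinal.mk B = Cardinal.continuum ∧
      Nonempty ((H →+ ℤ) ≃+ FreeAbelianGroup B) := by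
  obtain ⟨e⟩ := nonempty_equiv_of_countable (α := ℕ) (β := Idx)
  let ρ : limGroup →+ (ℕ → ℤ) :=
    { toFun := fun γ => γ.1.1 ∘ e
      map_zero' := rfl
      map_add' := fun _ _ => rfl }
  have hρ : Function.Injective ρ := by
    intro γ γ' h
    have h1 : γ.1.1 = γ'.1.1 := e.surjective.injective_comp_right h
    refine Subtype.ext (Prod.ext h1 (funext fun x => ?_))
    exact (γ.2.2 x).unique (h1 ▸ γ'.2.2 x)
  let b := Module.Basis.mk (linearIndependent_coord isThick_comap_limGroup isThick_map_limGroup)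
    (span_coord isThick_comap_limGroup isThick_map_limGroup)
  refine ⟨ρ.range, Idx ⊕ Set ℕ, by simp, ⟨?_⟩⟩
  exact ((AddMonoidHom.ofInjective hρ).symm.addMonoidHomCongrLeft).trans
    (b.repr.toAddEquiv.trans (FreeAbelianGroup.equivFinsupp _).symm)
end
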